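/- Let $\mathbb{B}$ be the open unit ball in $\mathbb{R}^d$, let $m$ be a natural number, and let $f:\mathbb{B}\to\mathbb{R}$ be of class $C^m$ on $\mathbb{B}$ (all partial derivatives of $f$ of order at most $m$ exist and are continuous on $\mathbb{B}$) with $\nabla f(x)\neq 0$ for every $x\in\mathbb{B}$. For a multiindex $\beta=(\beta_1,\dots,\beta_d)$ write $|\beta|=\beta_1+\dots+\beta_d$ and $\partial^\beta=\partial_1^{\beta_1}\cdots\partial_d^{\beta_d}$. Then for each $k=1,\dots,m-1$ there exist functions $F_\beta:\mathbb{B}\to\mathbb{C}$, one for each multiindex $\beta$ with $|\beta|\le k$, such that: (1) for every compactly supported $\psi:\mathbb{B}\to\mathbb{C}$ of class $C^m$, the function $e^{if}\sum_{|\beta|\le k}(\partial^\beta\psi)F_\beta$ is integrable on $\mathbb{B}$ and $$\int_{\mathbb{B}} e^{if(x)}\psi(x)\,dx=\int_{\mathbb{B}} e^{if(x)}\Big[\sum_{|\beta|\le k}(\partial^\beta\psi)(x)\,F_\beta(x)\Big]dx;$$ (2) there is a constant $C$ depending only on $d$ and $m$ such that, for every nonnegative function $\omega$ on $\mathbb{B}$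 satisfying $$\frac1{\omega(x)}\ \ge\ \sup_{2\le|\gamma|\le k+1}\left(\frac{|\partial^\gamma f(x)|}{|\nabla f(x)|}\right)^{1/(|\gamma|-1)}$$ at every $x\in\mathbb{B}$ (with $1/\omega(x)=+\infty$ where $\omega(x)=0$), one has $$|F_\beta(x)|\le C\,\frac{\omega(x)^{|\beta|}}{(\omega(x)\,|\nabla f(x)|)^{k}}$$ for all $|\beta|\le k$ and all $x\in\mathbb{B}$ with $\omega(x)>0$. -/

import Mathlib

/-- The partial derivative `∂_i g` of a function on `ℝ^d`. -/
noncomputable def partialDeriv {d : ℕ} {V : Type*} [NormedAddCommGroup V] [NormedSpace ℝ V]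
    (i : Fin d) (g : EuclideanSpace ℝ (Fin d) → V) : EuclideanSpace ℝ (Fin d) → V :=
  fun x => fderiv ℝ g x (EuclideanSpace.single i (1 : ℝ))

/-- The mixed partial derivative `∂^β g = ∂_1^{β_1} ⋯ ∂_d^{β_d} g` for a multiindex `β`.
At a point of an open set `U` it only depends on the values of `g` on `U`. -/
noncomputable def mixedPartial {d : ℕ} {V : Type*} [NormedAddCommGroup V] [NormedSpace ℝ V]
    (β : Fin d → ℕ) (g : EuclideanSpace ℝ (Fin d) → V) : EuclideanSpace ℝ (Fin d) → V :=
  (List.finRange d).foldr (fun i h => (partialDeriv i)^[β i] h) g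

/-- The order `|β|` of a multiindex. -/
def multiOrder {d : ℕ} (β : Fin d → ℕ) : ℕ := ∑ i, β i

/-- The finite set of all multiindices `β` in `d` variables with `|β| ≤ k`. -/
def multiIndicesLE (d k : ℕ) : Finset (Fin d → ℕ) :=
  {β ∈ Fintype.piFinset (fun _ : Fin d => Finset.range (k + 1)) | multiOrder β ≤ k}

theorem mem_multiIndicesLE {d k : ℕ} {β : Fin d → ℕ} :
    β ∈ multiIndicesLE d k ↔ multiOrder β ≤ k := by
  simp only [multiIndicesLE, Finset.mem_filter, Fintype.mem_piFinset, Finset.mem_range,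
    and_iff_right_iff_imp]
  intro h i
  have := Finset.single_le_sum (f := β) (fun j _ => Nat.zero_le _) (Finset.mem_univ i)
  unfold multiOrder at h
  omega

open Filter Topology MeasureTheory

section IntegrationByParts

variable {d : ℕ}

section PartialDeriv

variable {V : Type*} [NormedAddCommGroup V] [NormedSpace ℝ V]

theorem Filter.EventuallyEq.partialDeriv {g h : EuclideanSpace ℝ (Fin d) → V}
    {x : EuclideanSpace ℝ (Fin d)} (H : g =ᶠ[𝓝 x] h) (j : Fin d) :
    partialDeriv j g =ᶠ[𝓝 x] partialDeriv j h := by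
  filter_upwards [H.fderiv (𝕜 := ℝ)] with y hy
  simp only [_root_.partialDeriv, hy]

theorem ContDiffAt.partialDeriv {g : EuclideanSpace ℝ (Fin d) → V}
    {x : EuclideanSpace ℝ (Fin d)} {n : ℕ} (hg : ContDiffAt ℝ (n + 1 : ℕ) g x) (j : Fin d) :
    ContDiffAt ℝ n (partialDeriv j g) x :=
  (hg.fderiv_right (m := n) (by norm_cast)).clm_apply contDiffAt_const

theorem ContDiffAt.eventually_differentiableAt {g : EuclideanSpace ℝ (Fin d) → V}
    {x : EuclideanSpace ℝ (Fin d)} {n : ℕ} (hg : ContDiffAt ℝ n g x) (hn : n ≠ 0) :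
    ∀ᶠ y in 𝓝 x, DifferentiableAt ℝ g y := by
  filter_upwards [hg.eventually (by simp)] with y hy
  exact hy.differentiableAt (by exact_mod_cast hn)

theorem partialDeriv_add {g h : EuclideanSpace ℝ (Fin d) → V} {x : EuclideanSpace ℝ (Fin d)}
    (hg : DifferentiableAt ℝ g x) (hh : DifferentiableAt ℝ h x) (j : Fin d) :
    partialDeriv j (fun y => g y + h y) x = partialDeriv j g x + partialDeriv j h x := by
  simp [partialDeriv, fderiv_fun_add hg hh]

theorem partialDeriv_sum {ι : Type*} {s : Finset ι} {g : ι → EuclideanSpace ℝ (Fin d) → V}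
    {x : EuclideanSpace ℝ (Fin d)} (hg : ∀ i ∈ s, DifferentiableAt ℝ (g i) x) (j : Fin d) :
    partialDeriv j (fun y => ∑ i ∈ s, g i y) x = ∑ i ∈ s, partialDeriv j (g i) x := by
  simp [partialDeriv, fderiv_fun_sum hg]

theorem partialDeriv_mul {A : Type*} [NormedCommRing A] [NormedAlgebra ℝ A]
    {g h : EuclideanSpace ℝ (Fin d) → A} {x : EuclideanSpace ℝ (Fin d)}
    (hg : DifferentiableAt ℝ g x) (hh : DifferentiableAt ℝ h x) (j : Fin d) :
    partialDeriv j (fun y => g y * h y) x =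
      partialDeriv j g x * h x + g x * partialDeriv j h x := by
  simp [partialDeriv, fderiv_fun_mul hg hh]
  ring

theorem partialDeriv_inv {g : EuclideanSpace ℝ (Fin d) → ℝ} {x : EuclideanSpace ℝ (Fin d)}
    (hg : DifferentiableAt ℝ g x) (h0 : g x ≠ 0) (j : Fin d) :
    partialDeriv j (fun y => (g y)⁻¹) x =
      (-1) * (((g x)⁻¹ * (g x)⁻¹) * partialDeriv j g x) := by
  have := (hasDerivAt_inv h0).comp_hasFDerivAt x hg.hasFDerivAt
  have h2 : HasFDerivAt (fun y => (g y)⁻¹) (-(g x ^ 2)⁻¹ • fderiv ℝ g x) x := this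
  simp only [partialDeriv, h2.fderiv, neg_smul, neg_apply,
    smul_apply, smul_eq_mul]
  ring

theorem partialDeriv_const (c : V) (j : Fin d) :
    partialDeriv j (fun _ : EuclideanSpace ℝ (Fin d) => c) = fun _ => 0 := by
  funext x
  simp [partialDeriv]

theorem partialDeriv_ofReal {g : EuclideanSpace ℝ (Fin d) → ℝ} {x : EuclideanSpace ℝ (Fin d)}
    (hg : DifferentiableAt ℝ g x) (j : Fin d) :
    partialDeriv j (fun y => (g y : ℂ)) x = ((partialDeriv j g x : ℝ) : ℂ) := by
  have := Complex.ofRealCLM.hasFDerivAt.comp x hg.hasFDerivAt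
  have h2 : HasFDerivAt (fun y => (g y : ℂ)) (Complex.ofRealCLM.comp (fderiv ℝ g x)) x := this
  simp [partialDeriv, h2.fderiv]

theorem partialDeriv_comm {g : EuclideanSpace ℝ (Fin d) → V} {x : EuclideanSpace ℝ (Fin d)}
    (hg : ContDiffAt ℝ 2 g x) (i j : Fin d) :
    partialDeriv i (partialDeriv j g) x = partialDeriv j (partialDeriv i g) x := by
  have hs := hg.isSymmSndFDerivAt (by simp)
  have hd : DifferentiableAt ℝ (fderiv ℝ g) x :=
    (hg.fderiv_right (m := 1) (by norm_num)).differentiableAt (by simp)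
  have key : ∀ i j : Fin d, partialDeriv i (partialDeriv j g) x =
      fderiv ℝ (fderiv ℝ g) x (EuclideanSpace.single i 1) (EuclideanSpace.single j 1) := by
    intro i j
    unfold partialDeriv
    rw [fderiv_clm_apply hd (differentiableAt_const _)]
    simp
  rw [key, key]
  exact hs.eq _ _

/-- The iterated partial derivative along a list of coordinate directions. -/
noncomputable def listPartial (l : List (Fin d)) (g : EuclideanSpace ℝ (Fin d) → V) :
    EuclideanSpace ℝ (Fin d) → V :=
  l.foldr partialDeriv g

theorem ContDiffAt.listPartial {g : EuclideanSpace ℝ (Fin d) → V} {x : EuclideanSpace ℝ (Fin d)}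
    (l : List (Fin d)) {n : ℕ} (hg : ContDiffAt ℝ (n + l.length : ℕ) g x) :
    ContDiffAt ℝ n (listPartial l g) x := by
  induction l generalizing n with
  | nil => simpa [_root_.listPartial] using hg
  | cons i l ih =>
    have := ih (n := n + 1) (by simpa [add_assoc, add_comm, add_left_comm] using hg)
    exact this.partialDeriv i

theorem List.Perm.listPartial_eventuallyEq {l l' : List (Fin d)} (hl : l.Perm l')
    {g : EuclideanSpace ℝ (Fin d) → V} {x : EuclideanSpace ℝ (Fin d)}
    (hg : ContDiffAt ℝ l.length g x) : listPartial l g =ᶠ[𝓝 x] listPartial l' g := by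
  induction hl with
  | nil => rfl
  | cons i _ ih =>
    refine (ih (hg.of_le ?_)).partialDeriv i
    simp
  | swap i j l =>
    have h2 : ContDiffAt ℝ (2 : ℕ) (listPartial l g) x :=
      ContDiffAt.listPartial l (hg.of_le (by norm_cast; simp; omega))
    filter_upwards [h2.eventually (by simp)] with y hy
    exact partialDeriv_comm hy _ _
  | trans h₁ _ ih₁ ih₂ => exact (ih₁ hg).trans (ih₂ (by rwa [← h₁.length_eq]))

/-- The sorted list of directions in which each `i` occurs `β i` times. -/
def multiList (β : Fin d → ℕ) : List (Fin d) :=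
  (List.finRange d).flatMap fun i => List.replicate (β i) i

theorem count_multiList (β : Fin d → ℕ) (i : Fin d) : (multiList β).count i = β i := by
  rw [multiList, List.count_flatMap, List.sum_map_eq_nsmul_single i]
  · simp [List.count_eq_one_of_mem (List.nodup_finRange d) (List.mem_finRange i)]
  · intro j hj _
    simp [List.count_replicate, hj]

theorem length_multiList (β : Fin d → ℕ) : (multiList β).length = multiOrder β := by
  simp [multiList, multiOrder, List.length_flatMap, List.sum_ofFn, ← List.ofFn_eq_map]

theorem listPartial_append (l l' : List (Fin d)) (g : EuclideanSpace ℝ (Fin d) → V) :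
    listPartial (l ++ l') g = listPartial l (listPartial l' g) := by
  simp [listPartial]

theorem listPartial_replicate (n : ℕ) (i : Fin d) (g : EuclideanSpace ℝ (Fin d) → V) :
    listPartial (List.replicate n i) g = (partialDeriv i)^[n] g := by
  induction n with
  | zero => rfl
  | succ n ih => rw [Function.iterate_succ_apply', ← ih]; rfl

theorem mixedPartial_eq_listPartial (β : Fin d → ℕ) (g : EuclideanSpace ℝ (Fin d) → V) :
    mixedPartial β g = listPartial (multiList β) g := by
  unfold mixedPartial multiList
  induction List.finRange d with
  | nil => rfl
  | cons i l ih =>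
    rw [List.foldr_cons, ih, List.flatMap_cons, listPartial_append, listPartial_replicate]

theorem multiOrder_add_single (β : Fin d → ℕ) (j : Fin d) :
    multiOrder (β + Pi.single j 1) = multiOrder β + 1 := by
  simp [multiOrder, Finset.sum_add_distrib]

theorem ContDiffAt.mixedPartial {g : EuclideanSpace ℝ (Fin d) → V}
    {x : EuclideanSpace ℝ (Fin d)} {β : Fin d → ℕ} {n : ℕ}
    (hg : ContDiffAt ℝ (n + multiOrder β : ℕ) g x) : ContDiffAt ℝ n (mixedPartial β g) x := by
  rw [mixedPartial_eq_listPartial]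
  exact ContDiffAt.listPartial _ (by rwa [length_multiList])

theorem mixedPartial_zero (g : EuclideanSpace ℝ (Fin d) → V) : mixedPartial 0 g = g := by
  have : multiList (0 : Fin d → ℕ) = [] := by
    rw [← List.length_eq_zero_iff, length_multiList]
    simp [multiOrder]
  rw [mixedPartial_eq_listPartial, this]
  rfl

theorem partialDeriv_mixedPartial {g : EuclideanSpace ℝ (Fin d) → V}
    {x : EuclideanSpace ℝ (Fin d)} {β : Fin d → ℕ} (hg : ContDiffAt ℝ (multiOrder β + 1 : ℕ) g x)
    (j : Fin d) :
    partialDeriv j (mixedPartial β g) =ᶠ[𝓝 x] mixedPartial (β + Pi.single j 1) g := by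
  rw [mixedPartial_eq_listPartial, mixedPartial_eq_listPartial]
  refine List.Perm.listPartial_eventuallyEq (l := j :: multiList β) ?_ ?_
  · rw [List.perm_iff_count]
    intro i
    rw [count_multiList, List.count_cons, count_multiList]
    by_cases h : j = i
    · simp [h]
    · simp [h, Ne.symm h]
  · simpa [length_multiList] using hg

theorem tsupport_partialDeriv_subset (j : Fin d) (g : EuclideanSpace ℝ (Fin d) → V) :
    tsupport (partialDeriv j g) ⊆ tsupport g :=
  tsupport_fderiv_apply_subset ℝ _

theorem tsupport_mixedPartial_subset (β : Fin d → ℕ) (g : EuclideanSpace ℝ (Fin d) → V) :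
    tsupport (mixedPartial β g) ⊆ tsupport g := by
  rw [mixedPartial_eq_listPartial]
  induction multiList β with
  | nil => rfl
  | cons i l ih => exact (tsupport_partialDeriv_subset i _).trans ih

theorem gradient_apply (f : EuclideanSpace ℝ (Fin d) → ℝ) (x : EuclideanSpace ℝ (Fin d))
    (i : Fin d) : gradient f x i = partialDeriv i f x := by
  have h : inner ℝ (gradient f x) (EuclideanSpace.single i (1 : ℝ)) = partialDeriv i f x := by
    rw [← InnerProductSpace.toDual_apply_apply, toDual_gradient, partialDeriv]
  rw [← h]
  rw [EuclideanSpace.inner_single_right, one_mul, conj_trivial]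

theorem norm_gradient_sq (f : EuclideanSpace ℝ (Fin d) → ℝ) (x : EuclideanSpace ℝ (Fin d)) :
    ‖gradient f x‖ ^ 2 = ∑ i, partialDeriv i f x ^ 2 := by
  simp [EuclideanSpace.norm_sq_eq, gradient_apply]

theorem abs_partialDeriv_le (f : EuclideanSpace ℝ (Fin d) → ℝ) (x : EuclideanSpace ℝ (Fin d))
    (i : Fin d) : |partialDeriv i f x| ≤ ‖gradient f x‖ := by
  rw [← gradient_apply, ← Real.norm_eq_abs]
  exact PiLp.norm_apply_le _ _

end PartialDeriv

/-- The function `g` and its iterated partial derivatives of order at most `n` at `x` satisfy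
`|∂_{i_1} ⋯ ∂_{i_q} g x| ≤ M * r ^ q`. -/
def DerivBound (r : ℝ) (x : EuclideanSpace ℝ (Fin d)) :
    ℕ → ℝ → (EuclideanSpace ℝ (Fin d) → ℝ) → Prop
  | 0, M, g => |g x| ≤ M
  | n + 1, M, g => |g x| ≤ M ∧ ∀ j, DerivBound r x n (M * r) (partialDeriv j g)

namespace DerivBound

variable {r M N : ℝ} {x : EuclideanSpace ℝ (Fin d)} {n : ℕ} {g h : EuclideanSpace ℝ (Fin d) → ℝ}

theorem abs_le (hg : DerivBound r x n M g) : |g x| ≤ M := by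
  cases n with
  | zero => exact hg
  | succ n => exact hg.1

theorem nonneg (hg : DerivBound r x n M g) : 0 ≤ M :=
  (abs_nonneg _).trans hg.abs_le

theorem congr (hg : DerivBound r x n M g) (H : g =ᶠ[𝓝 x] h) : DerivBound r x n M h := by
  induction n generalizing M g h with
  | zero => simpa [DerivBound, H.eq_of_nhds] using hg
  | succ n ih => exact ⟨H.eq_of_nhds ▸ hg.1, fun j => ih (hg.2 j) (H.partialDeriv j)⟩

theorem mono (hr : 0 ≤ r) (hg : DerivBound r x n M g) (hMN : M ≤ N) : DerivBound r x n N g := by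
  induction n generalizing M N g with
  | zero => exact le_trans hg hMN
  | succ n ih =>
    exact ⟨hg.1.trans hMN, fun j => ih (hg.2 j) (mul_le_mul_of_nonneg_right hMN hr)⟩

theorem of_succ (hg : DerivBound r x (n + 1) M g) : DerivBound r x n M g := by
  induction n generalizing M g with
  | zero => exact hg.1
  | succ n ih => exact ⟨hg.1, fun j => ih (hg.2 j)⟩

theorem const (hr : 0 ≤ r) {c : ℝ} (hc : |c| ≤ M) : DerivBound r x n M fun _ => c := by
  induction n generalizing M c with
  | zero => exact hc
  | succ n ih =>
    refine ⟨hc, fun j => ?_⟩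
    rw [partialDeriv_const]
    exact ih (by simpa using mul_nonneg ((abs_nonneg _).trans hc) hr)

theorem add (hg : DerivBound r x n M g) (hh : DerivBound r x n N h)
    (cg : ContDiffAt ℝ n g x) (ch : ContDiffAt ℝ n h x) :
    DerivBound r x n (M + N) fun y => g y + h y := by
  induction n generalizing M N g h with
  | zero => exact (abs_add_le _ _).trans (add_le_add hg hh)
  | succ n ih =>
    refine ⟨(abs_add_le _ _).trans (add_le_add hg.1 hh.1), fun j => ?_⟩
    rw [add_mul]
    refine (ih (hg.2 j) (hh.2 j) (cg.partialDeriv j) (ch.partialDeriv j)).congr ?_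
    filter_upwards [cg.eventually_differentiableAt (by simp),
      ch.eventually_differentiableAt (by simp)] with y h₁ h₂
    exact (partialDeriv_add h₁ h₂ j).symm

theorem sum (hr : 0 ≤ r) {ι : Type*} {s : Finset ι} {g : ι → EuclideanSpace ℝ (Fin d) → ℝ}
    (hg : ∀ i ∈ s, DerivBound r x n M (g i)) (cg : ∀ i ∈ s, ContDiffAt ℝ n (g i) x) :
    DerivBound r x n (s.card * M) fun y => ∑ i ∈ s, g i y := by
  classical
  induction s using Finset.induction_on with
  | empty => simpa using DerivBound.const hr (c := 0) (by simp)
  | insert a s ha ih =>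
    simp only [Finset.sum_insert ha, Finset.card_insert_of_notMem ha]
    have := (hg a (by simp)).add
      (ih (fun i hi => hg i (by simp [hi])) (fun i hi => cg i (by simp [hi])))
      (cg a (by simp)) (ContDiffAt.sum fun i hi => cg i (by simp [hi]))
    convert this using 1
    push_cast
    ring

theorem mul (hg : DerivBound r x n M g) (hh : DerivBound r x n N h)
    (cg : ContDiffAt ℝ n g x) (ch : ContDiffAt ℝ n h x) :
    DerivBound r x n (2 ^ n * (M * N)) fun y => g y * h y := by
  have val : ∀ {M N : ℝ} {g h : EuclideanSpace ℝ (Fin d) → ℝ}, |g x| ≤ M → |h x| ≤ N →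
      |g x * h x| ≤ M * N := fun h₁ h₂ => by
    rw [abs_mul]
    exact mul_le_mul h₁ h₂ (abs_nonneg _) ((abs_nonneg _).trans h₁)
  induction n generalizing M N g h with
  | zero => simpa [DerivBound] using val hg hh
  | succ n ih =>
    have hMN : 0 ≤ M * N := mul_nonneg hg.nonneg hh.nonneg
    refine ⟨(val hg.1 hh.1).trans (le_mul_of_one_le_left hMN (one_le_pow₀ (by norm_num))),
      fun j => ?_⟩
    have cg' : ContDiffAt ℝ n g x := cg.of_le (by norm_cast; omega)
    have ch' : ContDiffAt ℝ n h x := ch.of_le (by norm_cast; omega)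
    have h₁ := ih (hg.2 j) hh.of_succ (cg.partialDeriv j) ch'
    have h₂ := ih hg.of_succ (hh.2 j) cg' (ch.partialDeriv j)
    have h₃ := h₁.add h₂ ((cg.partialDeriv j).mul ch') (cg'.mul (ch.partialDeriv j))
    have e : 2 ^ n * (M * r * N) + 2 ^ n * (M * (N * r)) = 2 ^ (n + 1) * (M * N) * r := by ring
    rw [e] at h₃
    refine h₃.congr ?_
    filter_upwards [cg.eventually_differentiableAt (by simp),
      ch.eventually_differentiableAt (by simp)] with y h₁ h₂
    exact (partialDeriv_mul h₁ h₂ j).symm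

theorem exists_inv (n : ℕ) {A : ℝ} (hA : 0 ≤ A) : ∃ D : ℝ, 0 ≤ D ∧
    ∀ {d : ℕ} {r : ℝ} {x : EuclideanSpace ℝ (Fin d)} {g : EuclideanSpace ℝ (Fin d) → ℝ},
      0 ≤ r → 0 < g x → ContDiffAt ℝ n g x → DerivBound r x n (A * g x) g →
      DerivBound r x n (D * (g x)⁻¹) fun y => (g y)⁻¹ := by
  induction n with
  | zero =>
    refine ⟨1, zero_le_one, fun _ h0 _ _ => ?_⟩
    simp [DerivBound, abs_of_pos h0]
  | succ n ih =>
    obtain ⟨D, hD, H⟩ := ih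
    refine ⟨1 + 8 ^ n * D ^ 2 * A, by positivity, fun {d r x g} hr h0 cg hg => ⟨?_, fun j => ?_⟩⟩
    · rw [abs_inv, abs_of_pos h0]
      exact le_mul_of_one_le_left (by positivity) (le_add_of_nonneg_right (by positivity))
    · have cg' : ContDiffAt ℝ n g x := cg.of_le (by norm_cast; omega)
      have ci := cg'.inv h0.ne'
      have hi := H hr h0 cg' hg.of_succ
      have h₁ := (hi.mul hi ci ci).mul (hg.2 j) (ci.mul ci) (cg.partialDeriv j)
      have h₂ := (DerivBound.const hr (c := -1) (M := 1) (by simp)).mul h₁ contDiffAt_const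
        ((ci.mul ci).mul (cg.partialDeriv j))
      refine (h₂.congr ?_).mono hr ?_
      · filter_upwards [cg.eventually_differentiableAt (by simp),
          cg.continuousAt.eventually_ne h0.ne'] with y h₁ h₂
        exact (partialDeriv_inv h₁ h₂ j).symm
      · have e : (8 : ℝ) ^ n = 2 ^ n * 2 ^ n * 2 ^ n := by
          rw [← mul_pow, ← mul_pow]; norm_num
        have e' : (2 : ℝ) ^ n * (1 * (2 ^ n * (2 ^ n * (D * (g x)⁻¹ * (D * (g x)⁻¹)) *
            (A * g x * r)))) = 8 ^ n * D ^ 2 * A * (g x)⁻¹ * r := by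
          rw [e]
          field_simp
        rw [e']
        have : 0 ≤ (g x)⁻¹ * r := by positivity
        nlinarith

theorem mixedPartial {f : EuclideanSpace ℝ (Fin d) → ℝ} (n p : ℕ)
    (hf : ContDiffAt ℝ (p + 1 + n : ℕ) f x)
    (hb : ∀ γ : Fin d → ℕ, 1 ≤ multiOrder γ → multiOrder γ ≤ p + 1 + n →
      |mixedPartial γ f x| ≤ M * r ^ (multiOrder γ - 1))
    {γ : Fin d → ℕ} (hγ : multiOrder γ = p + 1) :
    DerivBound r x n (M * r ^ p) (mixedPartial γ f) := by
  induction n generalizing p γ with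
  | zero => simpa [DerivBound, hγ] using hb γ (by omega) (by omega)
  | succ n ih =>
    refine ⟨by simpa [hγ] using hb γ (by omega) (by omega), fun j => ?_⟩
    have := ih (p + 1) (by convert hf using 2; omega) (fun γ h₁ h₂ => hb γ h₁ (by omega))
      (γ := γ + Pi.single j 1) (by rw [multiOrder_add_single, hγ])
    rw [pow_succ, ← mul_assoc] at this
    refine this.congr (partialDeriv_mixedPartial ?_ j).symm
    exact hf.of_le (by norm_cast; omega)

end DerivBound

theorem partialDeriv_eq_mixedPartial (f : EuclideanSpace ℝ (Fin d) → ℝ) (i : Fin d)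
    {x : EuclideanSpace ℝ (Fin d)} (hf : ContDiffAt ℝ 1 f x) :
    partialDeriv i f =ᶠ[𝓝 x] mixedPartial (Pi.single i 1) f := by
  have := partialDeriv_mixedPartial (g := f) (β := 0) (x := x) (by simpa [multiOrder] using hf) i
  rwa [mixedPartial_zero, zero_add] at this

/-- The `j`-th component of the vector field `∇f / |∇f|²`. -/
noncomputable def gradField (f : EuclideanSpace ℝ (Fin d) → ℝ) (j : Fin d) :
    EuclideanSpace ℝ (Fin d) → ℝ :=
  fun x => partialDeriv j f x * (∑ i, partialDeriv i f x * partialDeriv i f x)⁻¹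

theorem sum_partialDeriv_mul_self (f : EuclideanSpace ℝ (Fin d) → ℝ)
    (x : EuclideanSpace ℝ (Fin d)) :
    ∑ i, partialDeriv i f x * partialDeriv i f x = ‖gradient f x‖ ^ 2 := by
  simp only [norm_gradient_sq, ← sq]

theorem sum_partialDeriv_mul_gradField {f : EuclideanSpace ℝ (Fin d) → ℝ}
    {x : EuclideanSpace ℝ (Fin d)} (h0 : gradient f x ≠ 0) :
    ∑ j, partialDeriv j f x * gradField f j x = 1 := by
  simp only [gradField, ← mul_assoc, ← Finset.sum_mul]
  rw [sum_partialDeriv_mul_self]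
  exact mul_inv_cancel₀ (by simpa using h0)

theorem contDiffAt_gradField {f : EuclideanSpace ℝ (Fin d) → ℝ} {x : EuclideanSpace ℝ (Fin d)}
    {n : ℕ} (hf : ContDiffAt ℝ (n + 1 : ℕ) f x) (h0 : gradient f x ≠ 0) (j : Fin d) :
    ContDiffAt ℝ n (gradField f j) x := by
  refine (hf.partialDeriv j).mul (ContDiffAt.inv ?_ ?_)
  · exact ContDiffAt.sum fun i _ => (hf.partialDeriv i).mul (hf.partialDeriv i)
  · rw [sum_partialDeriv_mul_self]
    simpa using h0

theorem exists_derivBound_gradField (d n : ℕ) : ∃ C : ℝ, 0 ≤ C ∧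
    ∀ {f : EuclideanSpace ℝ (Fin d) → ℝ} {x : EuclideanSpace ℝ (Fin d)} {r : ℝ}, 0 ≤ r →
      ContDiffAt ℝ (n + 1 : ℕ) f x → gradient f x ≠ 0 →
      (∀ i, DerivBound r x n ‖gradient f x‖ (partialDeriv i f)) →
      ∀ j, DerivBound r x n (C * ‖gradient f x‖⁻¹) (gradField f j) := by
  obtain ⟨D, hD, H⟩ := DerivBound.exists_inv n (A := d * 2 ^ n) (by positivity)
  refine ⟨2 ^ n * D, by positivity, fun {f x r} hr hf h0 hb j => ?_⟩
  have hG : 0 < ‖gradient f x‖ := by simpa using h0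
  have cg : ContDiffAt ℝ n (fun y => ∑ i, partialDeriv i f y * partialDeriv i f y) x :=
    ContDiffAt.sum fun i _ => (hf.partialDeriv i).mul (hf.partialDeriv i)
  have hs := DerivBound.sum hr (s := Finset.univ)
    (fun i _ => (hb i).mul (hb i) (hf.partialDeriv i) (hf.partialDeriv i))
    (fun i _ => (hf.partialDeriv i).mul (hf.partialDeriv i))
  have hsx := sum_partialDeriv_mul_self f x
  have hi := H (g := fun y => ∑ i, partialDeriv i f y * partialDeriv i f y) hr
    (by simp only [hsx]; positivity) cg (by
      simp only [hsx]
      convert hs using 1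
      simp only [Finset.card_univ, Fintype.card_fin]
      ring)
  have hm := (hb j).mul hi (hf.partialDeriv j) (cg.inv (by simp only [hsx]; positivity))
  simp only [hsx] at hm
  refine hm.mono hr (le_of_eq ?_)
  field_simp

/-- The coefficients of `∂^β ψ` after `n` integrations by parts against `exp (I * f)`,
up to the factor `I ^ n`. -/
noncomputable def ibpCoeff (f : EuclideanSpace ℝ (Fin d) → ℝ) :
    ℕ → (Fin d → ℕ) → EuclideanSpace ℝ (Fin d) → ℝ
  | 0, β => fun _ => if β = 0 then 1 else 0
  | n + 1, β => fun x => ∑ j,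
      (partialDeriv j (fun y => gradField f j y * ibpCoeff f n β y) x +
        if β j = 0 then 0 else gradField f j x * ibpCoeff f n (β - Pi.single j 1) x)

theorem multiOrder_sub_single {β : Fin d → ℕ} {j : Fin d} (h : β j ≠ 0) :
    multiOrder (β - Pi.single j 1) + 1 = multiOrder β := by
  rw [← multiOrder_add_single (β - Pi.single j 1) j]
  congr 1
  funext i
  by_cases hi : i = j
  · subst hi; simp; omega
  · simp [hi]

theorem contDiffAt_ibpCoeff {f : EuclideanSpace ℝ (Fin d) → ℝ} {x : EuclideanSpace ℝ (Fin d)}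
    (h0 : gradient f x ≠ 0) (n p : ℕ) (hf : ContDiffAt ℝ (p + n + 1 : ℕ) f x) (β : Fin d → ℕ) :
    ContDiffAt ℝ p (ibpCoeff f n β) x := by
  induction n generalizing p β with
  | zero => exact contDiffAt_const
  | succ n ih =>
    have hf' : ContDiffAt ℝ (p + 1 + n + 1 : ℕ) f x := by convert hf using 2; omega
    refine ContDiffAt.sum fun j _ => ContDiffAt.add ?_ ?_
    · refine ContDiffAt.partialDeriv (ContDiffAt.mul ?_ (ih (p + 1) hf' β)) j
      exact contDiffAt_gradField (hf.of_le (by norm_cast; omega)) h0 j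
    · by_cases hβ : β j = 0
      · simpa [hβ] using contDiffAt_const
      · simp only [hβ, if_false]
        exact (contDiffAt_gradField (hf.of_le (by norm_cast; omega)) h0 j).mul
          (ih p (hf.of_le (by norm_cast; omega)) _)

theorem ibpCoeff_eq_zero (f : EuclideanSpace ℝ (Fin d) → ℝ) {n : ℕ} {β : Fin d → ℕ}
    (h : n < multiOrder β) : ibpCoeff f n β = fun _ => 0 := by
  induction n generalizing β with
  | zero =>
    have : β ≠ 0 := by rintro rfl; simp [multiOrder] at h
    simp [ibpCoeff, this]
  | succ n ih =>
    funext x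
    refine Finset.sum_eq_zero fun j _ => ?_
    rw [ih (by omega)]
    by_cases hβ : β j = 0
    · simp [hβ, partialDeriv_const]
    · have := multiOrder_sub_single hβ
      rw [ih (by omega)]
      simp [partialDeriv_const]

theorem exists_derivBound_ibpCoeff (d n p : ℕ) : ∃ C : ℝ, 0 ≤ C ∧
    ∀ {f : EuclideanSpace ℝ (Fin d) → ℝ} {x : EuclideanSpace ℝ (Fin d)} {w : ℝ}, 0 < w →
      ContDiffAt ℝ (p + n + 1 : ℕ) f x → gradient f x ≠ 0 →
      (∀ γ : Fin d → ℕ, 1 ≤ multiOrder γ → multiOrder γ ≤ p + n + 1 →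
        |mixedPartial γ f x| ≤ ‖gradient f x‖ * w⁻¹ ^ (multiOrder γ - 1)) →
      ∀ β, DerivBound w⁻¹ x p (C * (w ^ multiOrder β / (w * ‖gradient f x‖) ^ n))
        (ibpCoeff f n β) := by
  induction n generalizing p with
  | zero =>
    refine ⟨1, zero_le_one, fun {f x w} hw _ _ _ β => ?_⟩
    unfold ibpCoeff
    refine DerivBound.const (by positivity) ?_
    by_cases hβ : β = 0
    · simp [hβ, multiOrder]
    · simp only [hβ, if_false, abs_zero]
      positivity
  | succ n ih =>
    obtain ⟨Cn, hCn, Hn⟩ := ih (p + 1)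
    obtain ⟨Ca, hCa, Ha⟩ := exists_derivBound_gradField d (p + 1)
    refine ⟨d * (2 ^ (p + 1) * Ca * Cn + 2 ^ p * Ca * Cn), by positivity,
      fun {f x w} hw hf h0 hb β => ?_⟩
    have hr : 0 ≤ w⁻¹ := by positivity
    have hG : 0 < ‖gradient f x‖ := by simpa using h0
    have hf' : ContDiffAt ℝ (p + 1 + n + 1 : ℕ) f x := by convert hf using 2; omega
    have hfa : ContDiffAt ℝ (p + 1 + 1 : ℕ) f x := hf.of_le (by norm_cast; omega)
    have hcoeff := Hn hw hf' h0 (fun γ h₁ h₂ => hb γ h₁ (by omega))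
    have ha := Ha hr hfa h0 fun i => by
      have := DerivBound.mixedPartial (f := f) (M := ‖gradient f x‖) (r := w⁻¹) (x := x)
        (p + 1) 0 (hf.of_le (by norm_cast; omega)) (fun γ h₁ h₂ => hb γ h₁ (by omega))
        (γ := Pi.single i 1) (by simp [multiOrder])
      rw [pow_zero, mul_one] at this
      exact this.congr (partialDeriv_eq_mixedPartial f i (hf.of_le (by norm_cast; omega))).symm
    have ca := fun j => contDiffAt_gradField hfa h0 j
    have cc := fun β => contDiffAt_ibpCoeff h0 n (p + 1) hf' β
    have ca' := fun j => (ca j).of_le (m := p) (by norm_cast; omega)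
    have cc' := fun β => (cc β).of_le (m := p) (by norm_cast; omega)
    have c₂ : ∀ j, ContDiffAt ℝ p (fun x => if β j = 0 then 0 else
        gradField f j x * ibpCoeff f n (β - Pi.single j 1) x) x := fun j => by
      by_cases hβ : β j = 0
      · simpa [hβ] using contDiffAt_const
      · simpa only [hβ, if_false] using (ca' j).mul (cc' _)
    have c₁ := fun j => ((ca j).mul (cc β)).partialDeriv j
    have key : ∀ j, DerivBound w⁻¹ x p
        ((2 ^ (p + 1) * Ca * Cn + 2 ^ p * Ca * Cn) *
          (w ^ multiOrder β / (w * ‖gradient f x‖) ^ (n + 1)))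
        (fun x => partialDeriv j (fun y => gradField f j y * ibpCoeff f n β y) x +
        if β j = 0 then 0 else gradField f j x * ibpCoeff f n (β - Pi.single j 1) x) := by
      intro j
      rw [add_mul]
      refine DerivBound.add ?_ ?_ (c₁ j) (c₂ j)
      · refine (((ha j).mul (hcoeff β) (ca j) (cc β)).2 j).mono hr (le_of_eq ?_)
        field_simp
        ring
      · by_cases hβ : β j = 0
        · simp only [hβ, if_true]
          exact DerivBound.const hr (by rw [abs_zero]; positivity)
        · simp only [hβ, if_false]
          refine ((ha j).of_succ.mul (hcoeff _).of_succ (ca' j) (cc' _)).mono hr (le_of_eq ?_)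
          rw [← multiOrder_sub_single hβ]
          field_simp
          ring
    have := DerivBound.sum hr (s := Finset.univ) (fun j _ => key j)
      (fun j _ => (c₁ j).add (c₂ j))
    refine this.mono hr (le_of_eq ?_)
    simp only [Finset.card_univ, Fintype.card_fin]
    ring

theorem contDiff_of_tsupport {V : Type*} [NormedAddCommGroup V] [NormedSpace ℝ V] {n : ℕ}
    {u : EuclideanSpace ℝ (Fin d) → V} (h : ∀ x ∈ tsupport u, ContDiffAt ℝ n u x) :
    ContDiff ℝ n u := by
  rw [contDiff_iff_contDiffAt]
  intro x
  by_cases hx : x ∈ tsupport u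
  · exact h x hx
  · exact (contDiffAt_const (c := 0)).congr_of_eventuallyEq
      (notMem_tsupport_iff_eventuallyEq.mp hx)

theorem integrable_partialDeriv {u : EuclideanSpace ℝ (Fin d) → ℂ} (hu : ContDiff ℝ 1 u)
    (hc : HasCompactSupport u) (j : Fin d) : Integrable (partialDeriv j u) := by
  refine Continuous.integrable_of_hasCompactSupport ?_
    (hc.of_isClosed_subset (isClosed_tsupport _) (tsupport_partialDeriv_subset j u))
  exact (hu.continuous_fderiv (by simp)).clm_apply continuous_const

theorem integral_partialDeriv_eq_zero {u : EuclideanSpace ℝ (Fin d) → ℂ} (hu : ContDiff ℝ 1 u)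
    (hc : HasCompactSupport u) (j : Fin d) : ∫ x, partialDeriv j u x = 0 := by
  have := integral_mul_fderiv_eq_neg_fderiv_mul_of_integrable (μ := volume)
    (f := fun _ : EuclideanSpace ℝ (Fin d) => (1 : ℂ)) (g := u)
    (v := EuclideanSpace.single j (1 : ℝ)) (by simp)
    (by simpa [partialDeriv] using! integrable_partialDeriv hu hc j)
    (by simpa using hu.continuous.integrable_of_hasCompactSupport hc)
    (fun x _ => differentiableAt_const _) (fun x _ => hu.differentiable (by simp) x)
  simpa [partialDeriv] using this

theorem tsupport_subset_of_forall {V W : Type*} [Zero V] [Zero W]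
    {u : EuclideanSpace ℝ (Fin d) → V} {v : EuclideanSpace ℝ (Fin d) → W}
    (h : ∀ x, u x = 0 → v x = 0) : tsupport v ⊆ tsupport u :=
  closure_mono fun x hx hu => hx (h x hu)

theorem contDiffAt_exp_mul {f : EuclideanSpace ℝ (Fin d) → ℝ} {x : EuclideanSpace ℝ (Fin d)}
    {n : ℕ} (hf : ContDiffAt ℝ n f x) :
    ContDiffAt ℝ n (fun y => Complex.exp (Complex.I * (f y : ℂ))) x :=
  (contDiffAt_const.mul (Complex.ofRealCLM.contDiff.contDiffAt.comp x hf)).cexp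

theorem partialDeriv_exp_mul {f : EuclideanSpace ℝ (Fin d) → ℝ} {x : EuclideanSpace ℝ (Fin d)}
    (hf : DifferentiableAt ℝ f x) (j : Fin d) :
    partialDeriv j (fun y => Complex.exp (Complex.I * (f y : ℂ))) x =
      Complex.exp (Complex.I * (f x : ℂ)) * (Complex.I * (partialDeriv j f x : ℝ)) := by
  have h₁ : HasFDerivAt (fun y => (f y : ℂ)) (Complex.ofRealCLM.comp (fderiv ℝ f x)) x :=
    Complex.ofRealCLM.hasFDerivAt.comp x hf.hasFDerivAt
  simp [partialDeriv, ((h₁.const_mul Complex.I).cexp).fderiv]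

theorem integrableOn_exp_mul {f : EuclideanSpace ℝ (Fin d) → ℝ}
    {U : Set (EuclideanSpace ℝ (Fin d))} {φ : EuclideanSpace ℝ (Fin d) → ℂ}
    (hf : ∀ x ∈ U, ContDiffAt ℝ (0 : ℕ) f x) (hφ : ∀ x ∈ U, ContDiffAt ℝ (0 : ℕ) φ x)
    (hc : HasCompactSupport φ) (hs : tsupport φ ⊆ U) :
    IntegrableOn (fun x => Complex.exp (Complex.I * (f x : ℂ)) * φ x) U := by
  have hts : tsupport (fun x => Complex.exp (Complex.I * (f x : ℂ)) * φ x) ⊆ tsupport φ :=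
    tsupport_subset_of_forall fun x hx => by simp [hx]
  refine Integrable.integrableOn (Continuous.integrable_of_hasCompactSupport ?_
    (hc.of_isClosed_subset (isClosed_tsupport _) hts))
  refine ContDiff.continuous (𝕜 := ℝ) (n := (0 : ℕ)) (contDiff_of_tsupport fun x hx => ?_)
  exact (contDiffAt_exp_mul (hf x (hs (hts hx)))).mul (hφ x (hs (hts hx)))

theorem integral_exp_mul_eq_integral_exp_mul_div {f : EuclideanSpace ℝ (Fin d) → ℝ}
    {U : Set (EuclideanSpace ℝ (Fin d))} (hU : MeasurableSet U)
    {φ : EuclideanSpace ℝ (Fin d) → ℂ}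
    (hf : ∀ x ∈ U, ContDiffAt ℝ (2 : ℕ) f x) (h0 : ∀ x ∈ U, gradient f x ≠ 0)
    (hφ : ∀ x ∈ U, ContDiffAt ℝ (1 : ℕ) φ x)
    (hc : HasCompactSupport φ) (hs : tsupport φ ⊆ U) :
    ∫ x in U, Complex.exp (Complex.I * (f x : ℂ)) * φ x =
      ∫ x in U, Complex.exp (Complex.I * (f x : ℂ)) *
        (Complex.I * ∑ j, partialDeriv j (fun y => φ y * (gradField f j y : ℂ)) x) := by
  set u : Fin d → EuclideanSpace ℝ (Fin d) → ℂ := fun j x =>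
    Complex.exp (Complex.I * (f x : ℂ)) * (φ x * (gradField f j x : ℂ)) with hu
  have hts : ∀ j, tsupport (u j) ⊆ tsupport φ := fun j =>
    tsupport_subset_of_forall fun x hx => by simp [hu, hx]
  have cf : ∀ x ∈ U, ContDiffAt ℝ (1 : ℕ) f x := fun x hx =>
    (hf x hx).of_le (by norm_cast)
  have ca : ∀ j, ∀ x ∈ U, ContDiffAt ℝ (1 : ℕ) (fun y => φ y * (gradField f j y : ℂ)) x :=
    fun j x hx => (hφ x hx).mul
      (Complex.ofRealCLM.contDiff.contDiffAt.comp x (contDiffAt_gradField (hf x hx) (h0 x hx) j))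
  have cu : ∀ j, ContDiff ℝ 1 (u j) := fun j => contDiff_of_tsupport (n := 1) fun x hx =>
    (contDiffAt_exp_mul (cf x (hs (hts j hx)))).mul (ca j x (hs (hts j hx)))
  have hcu : ∀ j, HasCompactSupport (u j) := fun j =>
    hc.of_isClosed_subset (isClosed_tsupport _) (hts j)
  have hint : ∀ j, Integrable (partialDeriv j (u j)) := fun j =>
    integrable_partialDeriv (cu j) (hcu j) j
  have hzero : ∀ j, ∫ x in U, partialDeriv j (u j) x = 0 := fun j => by
    rw [setIntegral_eq_integral_of_forall_compl_eq_zero, integral_partialDeriv_eq_zero (cu j) (hcu j)]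
    intro x hx
    exact image_eq_zero_of_notMem_tsupport fun h =>
      hx (hs (hts j (tsupport_partialDeriv_subset j _ h)))
  have key : ∀ x ∈ U, Complex.exp (Complex.I * (f x : ℂ)) *
        (Complex.I * ∑ j, partialDeriv j (fun y => φ y * (gradField f j y : ℂ)) x) =
      Complex.exp (Complex.I * (f x : ℂ)) * φ x +
        Complex.I * ∑ j, partialDeriv j (u j) x := by
    intro x hx
    have h₁ : ∀ j, partialDeriv j (u j) x = Complex.exp (Complex.I * (f x : ℂ)) *
        (Complex.I * φ x * ((partialDeriv j f x * gradField f j x : ℝ) : ℂ) +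
          partialDeriv j (fun y => φ y * (gradField f j y : ℂ)) x) := by
      intro j
      rw [hu]
      simp only
      rw [partialDeriv_mul ((contDiffAt_exp_mul (cf x hx)).differentiableAt (by simp))
        ((ca j x hx).differentiableAt (by simp)),
        partialDeriv_exp_mul ((cf x hx).differentiableAt (by simp))]
      push_cast
      ring
    simp only [h₁]
    rw [← Finset.mul_sum, Finset.sum_add_distrib, ← Finset.mul_sum, ← Complex.ofReal_sum,
      sum_partialDeriv_mul_gradField (h0 x hx), Complex.ofReal_one]
    linear_combination Complex.exp (Complex.I * (f x : ℂ)) * φ x * -Complex.I_sq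
  rw [setIntegral_congr_fun hU key, integral_add, integral_const_mul, integral_finsetSum]
  · simp [hzero]
  · exact fun j _ => (hint j).integrableOn
  · exact integrableOn_exp_mul (fun x hx => (cf x hx).of_le (by norm_cast))
      (fun x hx => (hφ x hx).of_le (by norm_cast)) hc hs
  · exact (integrable_finsetSum _ fun j _ => (hint j).integrableOn).const_mul _

/-- The coefficients of `∂^β ψ` after `n` integrations by parts against `exp (I * f)`. -/
noncomputable def ibpFactor (f : EuclideanSpace ℝ (Fin d) → ℝ) (n : ℕ) (β : Fin d → ℕ)
    (x : EuclideanSpace ℝ (Fin d)) : ℂ :=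
  Complex.I ^ n * (ibpCoeff f n β x : ℂ)

/-- The amplitude obtained from `ψ` after `n` integrations by parts against `exp (I * f)`. -/
noncomputable def ibpAmplitude (f : EuclideanSpace ℝ (Fin d) → ℝ)
    (ψ : EuclideanSpace ℝ (Fin d) → ℂ) (n : ℕ) (x : EuclideanSpace ℝ (Fin d)) : ℂ :=
  ∑ β ∈ multiIndicesLE d n, mixedPartial β ψ x * ibpFactor f n β x

theorem sum_multiIndicesLE_succ_shift {A : Type*} [AddCommMonoid A] (n : ℕ) (j : Fin d)
    (H : (Fin d → ℕ) → (Fin d → ℕ) → A) :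
    ∑ β ∈ multiIndicesLE d (n + 1), (if β j = 0 then 0 else H β (β - Pi.single j 1)) =
      ∑ β ∈ multiIndicesLE d n, H (β + Pi.single j 1) β := by
  have hite : ∀ β : Fin d → ℕ, (if β j = 0 then 0 else H β (β - Pi.single j 1)) =
      if β j ≠ 0 then H β (β - Pi.single j 1) else 0 := fun β => by
    by_cases h : β j = 0 <;> simp [h]
  have hsub : ∀ β : Fin d → ℕ, β j ≠ 0 → β - Pi.single j 1 + Pi.single j 1 = β := by
    intro β hβ
    funext i
    by_cases hi : i = j
    · subst hi; simp; omega
    · simp [hi]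
  simp only [hite]
  rw [← Finset.sum_filter]
  refine Finset.sum_nbij' (fun β => β - Pi.single j 1) (fun β => β + Pi.single j 1) ?_ ?_ ?_ ?_ ?_
  · intro β hβ
    simp only [Finset.mem_filter, mem_multiIndicesLE] at hβ ⊢
    have := multiOrder_sub_single hβ.2
    omega
  · intro β hβ
    simp only [Finset.mem_filter, mem_multiIndicesLE, multiOrder_add_single] at hβ ⊢
    exact ⟨by omega, by simp⟩
  · intro β hβ
    exact hsub β (Finset.mem_filter.mp hβ).2
  · intro β _
    simp
  · intro β hβ
    rw [hsub β (Finset.mem_filter.mp hβ).2]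

theorem contDiffAt_ibpFactor {f : EuclideanSpace ℝ (Fin d) → ℝ} {x : EuclideanSpace ℝ (Fin d)}
    (h0 : gradient f x ≠ 0) (n p : ℕ) (hf : ContDiffAt ℝ (p + n + 1 : ℕ) f x) (β : Fin d → ℕ) :
    ContDiffAt ℝ p (ibpFactor f n β) x :=
  contDiffAt_const.mul
    (Complex.ofRealCLM.contDiff.contDiffAt.comp x (contDiffAt_ibpCoeff h0 n p hf β))

theorem contDiffAt_ibpAmplitude {f : EuclideanSpace ℝ (Fin d) → ℝ}
    {ψ : EuclideanSpace ℝ (Fin d) → ℂ} {x : EuclideanSpace ℝ (Fin d)} (h0 : gradient f x ≠ 0)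
    (n p : ℕ) (hf : ContDiffAt ℝ (p + n + 1 : ℕ) f x) (hψ : ContDiffAt ℝ (p + n : ℕ) ψ x) :
    ContDiffAt ℝ p (ibpAmplitude f ψ n) x := by
  refine ContDiffAt.sum fun β hβ => ContDiffAt.mul ?_ (contDiffAt_ibpFactor h0 n p hf β)
  rw [mem_multiIndicesLE] at hβ
  exact ContDiffAt.mixedPartial (hψ.of_le (by norm_cast; omega))

theorem tsupport_ibpAmplitude_subset (f : EuclideanSpace ℝ (Fin d) → ℝ)
    (ψ : EuclideanSpace ℝ (Fin d) → ℂ) (n : ℕ) : tsupport (ibpAmplitude f ψ n) ⊆ tsupport ψ := by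
  refine closure_minimal (fun x hx => ?_) (isClosed_tsupport _)
  by_contra h
  refine hx (Finset.sum_eq_zero fun β _ => ?_)
  rw [image_eq_zero_of_notMem_tsupport fun h' => h (tsupport_mixedPartial_subset β ψ h'), zero_mul]

theorem ibpAmplitude_succ {f : EuclideanSpace ℝ (Fin d) → ℝ}
    {ψ : EuclideanSpace ℝ (Fin d) → ℂ} {x : EuclideanSpace ℝ (Fin d)} (h0 : gradient f x ≠ 0)
    (n : ℕ) (hf : ContDiffAt ℝ (n + 2 : ℕ) f x) (hψ : ContDiffAt ℝ (n + 1 : ℕ) ψ x) :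
    ibpAmplitude f ψ (n + 1) x =
      Complex.I * ∑ j, partialDeriv j (fun y => ibpAmplitude f ψ n y * (gradField f j y : ℂ)) x := by
  have ca : ∀ j, ContDiffAt ℝ (1 : ℕ) (gradField f j) x := fun j =>
    contDiffAt_gradField (hf.of_le (by norm_cast; omega)) h0 j
  have cc : ∀ β, ContDiffAt ℝ (1 : ℕ) (ibpCoeff f n β) x := fun β =>
    contDiffAt_ibpCoeff h0 n 1 (hf.of_le (by norm_cast; omega)) β
  have dac : ∀ j β, DifferentiableAt ℝ (fun y => gradField f j y * ibpCoeff f n β y) x :=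
    fun j β => ((ca j).mul (cc β)).differentiableAt (by simp)
  have dacC : ∀ j β, DifferentiableAt ℝ
      (fun y => ((gradField f j y * ibpCoeff f n β y : ℝ) : ℂ)) x :=
    fun j β => Complex.ofRealCLM.differentiableAt.comp x (dac j β)
  have dψ : ∀ β ∈ multiIndicesLE d n, DifferentiableAt ℝ (mixedPartial β ψ) x := fun β hβ => by
    rw [mem_multiIndicesLE] at hβ
    exact (ContDiffAt.mixedPartial (n := 1)
      (hψ.of_le (by norm_cast; omega))).differentiableAt (by simp)
  have dIψ : ∀ β ∈ multiIndicesLE d n,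
      DifferentiableAt ℝ (fun y => Complex.I ^ n * mixedPartial β ψ y) x := fun β hβ =>
    (dψ β hβ).const_mul _
  have step : ∀ j, partialDeriv j (fun y => ibpAmplitude f ψ n y * (gradField f j y : ℂ)) x =
      Complex.I ^ n * ∑ β ∈ multiIndicesLE d n,
        (mixedPartial (β + Pi.single j 1) ψ x *
            ((gradField f j x * ibpCoeff f n β x : ℝ) : ℂ) +
          mixedPartial β ψ x *
            (partialDeriv j (fun y => gradField f j y * ibpCoeff f n β y) x : ℝ)) := by
    intro j
    have e : (fun y => ibpAmplitude f ψ n y * (gradField f j y : ℂ)) = fun y =>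
        ∑ β ∈ multiIndicesLE d n, (Complex.I ^ n * mixedPartial β ψ y) *
          ((gradField f j y * ibpCoeff f n β y : ℝ) : ℂ) := by
      funext y
      rw [ibpAmplitude, Finset.sum_mul]
      refine Finset.sum_congr rfl fun β _ => ?_
      rw [ibpFactor]
      push_cast
      ring
    rw [e, partialDeriv_sum fun β hβ => (dIψ β hβ).fun_mul (dacC j β), Finset.mul_sum]
    refine Finset.sum_congr rfl fun β hβ => ?_
    have hβ' := mem_multiIndicesLE.mp hβ
    rw [partialDeriv_mul (dIψ β hβ) (dacC j β), partialDeriv_ofReal (dac j β),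
      partialDeriv_mul (differentiableAt_const _) (dψ β hβ), partialDeriv_const,
      (partialDeriv_mixedPartial (hψ.of_le (by norm_cast; omega)) j).eq_of_nhds]
    ring
  simp only [step]
  rw [← Finset.mul_sum, ← mul_assoc, ← pow_succ', ibpAmplitude]
  simp only [ibpFactor, ibpCoeff]
  have hsplit : ∀ β : Fin d → ℕ, mixedPartial β ψ x * (Complex.I ^ (n + 1) * ((∑ j,
      (partialDeriv j (fun y => gradField f j y * ibpCoeff f n β y) x +
        if β j = 0 then 0 else gradField f j x * ibpCoeff f n (β - Pi.single j 1) x) : ℝ) : ℂ)) =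
      Complex.I ^ (n + 1) * ∑ j, ((if β j = 0 then 0 else mixedPartial β ψ x *
          ((gradField f j x * ibpCoeff f n (β - Pi.single j 1) x : ℝ) : ℂ)) +
        mixedPartial β ψ x *
          (partialDeriv j (fun y => gradField f j y * ibpCoeff f n β y) x : ℝ)) := by
    intro β
    rw [mul_left_comm, Complex.ofReal_sum, Finset.mul_sum]
    congr 1
    refine Finset.sum_congr rfl fun j _ => ?_
    by_cases hβ : β j = 0
    · simp [hβ]
    · simp only [hβ, if_false]
      push_cast
      ring
  simp only [hsplit]
  rw [← Finset.mul_sum, Finset.sum_comm]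
  congr 1
  refine Finset.sum_congr rfl fun j _ => ?_
  rw [Finset.sum_add_distrib, Finset.sum_add_distrib,
    sum_multiIndicesLE_succ_shift n j fun β γ => mixedPartial β ψ x *
      ((gradField f j x * ibpCoeff f n γ x : ℝ) : ℂ)]
  congr 1
  symm
  refine Finset.sum_subset (fun β hβ => ?_) fun β _ hβ => ?_
  · rw [mem_multiIndicesLE] at hβ ⊢
    omega
  · rw [mem_multiIndicesLE, not_le] at hβ
    rw [ibpCoeff_eq_zero f hβ]
    simp [partialDeriv_const]

theorem integral_exp_mul_eq_ibpAmplitude {f : EuclideanSpace ℝ (Fin d) → ℝ}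
    {U : Set (EuclideanSpace ℝ (Fin d))} (hU : MeasurableSet U)
    {ψ : EuclideanSpace ℝ (Fin d) → ℂ} (h0 : ∀ x ∈ U, gradient f x ≠ 0)
    (hc : HasCompactSupport ψ) (hs : tsupport ψ ⊆ U) (n : ℕ)
    (hf : ∀ x ∈ U, ContDiffAt ℝ (n + 1 : ℕ) f x) (hψ : ∀ x ∈ U, ContDiffAt ℝ n ψ x) :
    ∫ x in U, Complex.exp (Complex.I * (f x : ℂ)) * ψ x =
      ∫ x in U, Complex.exp (Complex.I * (f x : ℂ)) * ibpAmplitude f ψ n x := by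
  induction n with
  | zero =>
    have e : multiIndicesLE d 0 = {0} := by
      ext β
      rw [mem_multiIndicesLE, Finset.mem_singleton]
      simp [multiOrder, funext_iff]
    simp [ibpAmplitude, e, ibpFactor, ibpCoeff, mixedPartial_zero]
  | succ n ih =>
    have hf' : ∀ x ∈ U, ContDiffAt ℝ (n + 2 : ℕ) f x := hf
    rw [ih (fun x hx => (hf x hx).of_le (by norm_cast; omega))
      (fun x hx => (hψ x hx).of_le (by norm_cast; omega)),
      integral_exp_mul_eq_integral_exp_mul_div hU
        (fun x hx => (hf x hx).of_le (by norm_cast; omega)) h0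
        (fun x hx => contDiffAt_ibpAmplitude (h0 x hx) n 1
          ((hf x hx).of_le (by norm_cast; omega)) ((hψ x hx).of_le (by norm_cast; omega)))
        (hc.of_isClosed_subset (isClosed_tsupport _) (tsupport_ibpAmplitude_subset f ψ n))
        ((tsupport_ibpAmplitude_subset f ψ n).trans hs)]
    refine setIntegral_congr_fun hU fun x hx => ?_
    rw [ibpAmplitude_succ (h0 x hx) n (hf' x hx) (hψ x hx)]

theorem abs_mixedPartial_le {f : EuclideanSpace ℝ (Fin d) → ℝ} {x : EuclideanSpace ℝ (Fin d)}
    {w : ℝ} (hf : ContDiffAt ℝ 1 f x) (h0 : gradient f x ≠ 0) {γ : Fin d → ℕ}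
    (hγ : 1 ≤ multiOrder γ)
    (hb : 2 ≤ multiOrder γ →
      (|mixedPartial γ f x| / ‖gradient f x‖) ^ (1 / ((multiOrder γ : ℝ) - 1)) ≤ 1 / w) :
    |mixedPartial γ f x| ≤ ‖gradient f x‖ * w⁻¹ ^ (multiOrder γ - 1) := by
  have hG : 0 < ‖gradient f x‖ := by simpa using h0
  rcases hγ.eq_or_lt with h1 | h2
  · obtain ⟨i, hi⟩ : ∃ i, γ i ≠ 0 := by
      by_contra! h
      simp [multiOrder, h] at h1
    have hz := multiOrder_sub_single hi
    have hγi : γ = Pi.single i 1 := by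
      have hz' : ∀ j, (γ - Pi.single i 1 : Fin d → ℕ) j = 0 := by
        have : multiOrder (γ - Pi.single i 1) = 0 := by omega
        simpa [multiOrder] using this
      funext j
      by_cases hj : j = i
      · subst hj
        have := hz' j
        simp at this
        simp
        omega
      · simpa [hj] using hz' j
    rw [← h1, hγi, ← (partialDeriv_eq_mixedPartial f i hf).eq_of_nhds]
    simpa using abs_partialDeriv_le f x i
  · have hq := hb h2
    have hn : ((multiOrder γ - 1 : ℕ) : ℝ) = (multiOrder γ : ℝ) - 1 := by
      push_cast [hγ]; rfl
    rw [← hn, one_div, one_div] at hq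
    have h3 : |mixedPartial γ f x| / ‖gradient f x‖ ≤ w⁻¹ ^ (multiOrder γ - 1) := by
      calc |mixedPartial γ f x| / ‖gradient f x‖
          = ((|mixedPartial γ f x| / ‖gradient f x‖) ^
              (((multiOrder γ - 1 : ℕ) : ℝ)⁻¹)) ^ (multiOrder γ - 1) :=
            (Real.rpow_inv_natCast_pow (by positivity) (by omega)).symm
        _ ≤ _ := pow_le_pow_left₀ (by positivity) hq _
    rwa [div_le_iff₀' hG] at h3

end IntegrationByParts

theorem statement_1 (d m : ℕ) :
    ∃ C : ℝ, 0 < C ∧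
      ∀ f : EuclideanSpace ℝ (Fin d) → ℝ,
        ContDiffOn ℝ m f (Metric.ball 0 1) →
        (∀ x ∈ Metric.ball (0 : EuclideanSpace ℝ (Fin d)) 1, gradient f x ≠ 0) →
        ∀ k : ℕ, 1 ≤ k → k + 1 ≤ m →
          ∃ F : (Fin d → ℕ) → EuclideanSpace ℝ (Fin d) → ℂ,
            (∀ ψ : EuclideanSpace ℝ (Fin d) → ℂ,
              ContDiff ℝ m ψ → HasCompactSupport ψ → tsupport ψ ⊆ Metric.ball 0 1 →
              MeasureTheory.IntegrableOn
                (fun x => Complex.exp (Complex.I * (f x : ℂ)) *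
                  ∑ β ∈ multiIndicesLE d k, mixedPartial β ψ x * F β x)
                (Metric.ball (0 : EuclideanSpace ℝ (Fin d)) 1) ∧
              (∫ x in Metric.ball (0 : EuclideanSpace ℝ (Fin d)) 1,
                  Complex.exp (Complex.I * (f x : ℂ)) * ψ x) =
                ∫ x in Metric.ball (0 : EuclideanSpace ℝ (Fin d)) 1,
                  Complex.exp (Complex.I * (f x : ℂ)) *
                    ∑ β ∈ multiIndicesLE d k, mixedPartial β ψ x * F β x) ∧
            (∀ ω : EuclideanSpace ℝ (Fin d) → ℝ,
              (∀ x ∈ Metric.ball (0 : EuclideanSpace ℝ (Fin d)) 1, 0 ≤ ω x) →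
              -- where `ω x = 0`, `1 / ω x` is read as `+∞` and the condition is void
              (∀ x ∈ Metric.ball (0 : EuclideanSpace ℝ (Fin d)) 1, 0 < ω x →
                ∀ γ : Fin d → ℕ, 2 ≤ multiOrder γ → multiOrder γ ≤ k + 1 →
                  (|mixedPartial γ f x| / ‖gradient f x‖) ^ (1 / ((multiOrder γ : ℝ) - 1)) ≤
                    1 / ω x) →
              ∀ x ∈ Metric.ball (0 : EuclideanSpace ℝ (Fin d)) 1, 0 < ω x →
                ∀ β : Fin d → ℕ, multiOrder β ≤ k →
                  ‖F β x‖ ≤ C * (ω x ^ multiOrder β / (ω x * ‖gradient f x‖) ^ k)) := by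
  choose c hc H using fun k => exists_derivBound_ibpCoeff d k 0
  refine ⟨1 + ∑ k ∈ Finset.range m, c k, by
    have := Finset.sum_nonneg fun k (_ : k ∈ Finset.range m) => hc k
    positivity, fun f hf h0 k _ hkm => ⟨ibpFactor f k, ?_, ?_⟩⟩
  all_goals
    have cf : ∀ x ∈ Metric.ball (0 : EuclideanSpace ℝ (Fin d)) 1, ContDiffAt ℝ m f x :=
      fun x hx => hf.contDiffAt (Metric.isOpen_ball.mem_nhds hx)
  · intro ψ hψ hcψ hs
    refine ⟨?_, ?_⟩
    · refine integrableOn_exp_mul (φ := ibpAmplitude f ψ k)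
        (fun x hx => (cf x hx).of_le (by norm_cast; omega))
        (fun x hx => contDiffAt_ibpAmplitude (h0 x hx) k 0 ((cf x hx).of_le (by norm_cast; omega))
          (hψ.contDiffAt.of_le (by norm_cast; omega)))
        (hcψ.of_isClosed_subset (isClosed_tsupport _) (tsupport_ibpAmplitude_subset f ψ k))
        ((tsupport_ibpAmplitude_subset f ψ k).trans hs)
    · exact integral_exp_mul_eq_ibpAmplitude Metric.isOpen_ball.measurableSet h0 hcψ hs k
        (fun x hx => (cf x hx).of_le (by norm_cast))
        (fun x _ => hψ.contDiffAt.of_le (by norm_cast; omega))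
  · intro ω _ hω x hx hωx β _
    have hb := (H k hωx ((cf x hx).of_le (by norm_cast; omega)) (h0 x hx)
      (fun γ h₁ h₂ => abs_mixedPartial_le ((cf x hx).of_le (by norm_cast; omega)) (h0 x hx) h₁
        fun h₃ => hω x hx hωx γ h₃ (by omega)) β).abs_le
    have hn : ‖ibpFactor f k β x‖ = |ibpCoeff f k β x| := by simp [ibpFactor]
    rw [hn]
    refine hb.trans (mul_le_mul_of_nonneg_right ?_ (by positivity))
    have := Finset.single_le_sum (f := c) (fun k _ => hc k) (Finset.mem_range.mpr hkm)
    linarith
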